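/- Let N ≥ 2, J ∈ ℝ, and let λ₁, …, λ_ℓ ∈ ℂ be pairwise distinct with λ_j ≠ i/2, λ_j ≠ −i/2, and λ_k − λ_j ≠ i for all j ≠ k, satisfying the Bethe ansatz equations. Then the Bethe vector Ψ = B_N(λ₁) ⋯ B_N(λ_ℓ) |0⟩_N satisfies ℋ_N Ψ = ℰ Ψ with energy eigenvalue ℰ = −(J/2) Σ_{j=1}^{ℓ} 1/(λ_j² + 1/4). -/

import Mathlib

open Complex Matrix Filter Topology

noncomputable section

/-- The index set of the standard basis of `𝔥_N = (ℂ²)^{⊗N}`. -/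
abbrev St (N : ℕ) := Fin N → Fin 2

/-- The Pauli matrices `σ¹, σ², σ³`. -/
def pauli : Fin 3 → Matrix (Fin 2) (Fin 2) ℂ
  | 0 => !![0, 1; 1, 0]
  | 1 => !![0, -Complex.I; Complex.I, 0]
  | 2 => !![1, 0; 0, -1]

/-- The operator `σₖᵃ` on `𝔥_N`, acting as `σᵃ` on the `k`-th tensor factor
and as the identity on the others. -/
def siteOp (N : ℕ) (a : Fin 3) (k : Fin N) : Matrix (St N) (St N) ℂ :=
  Matrix.of fun x y =>
    pauli a (x k) (y k) * ∏ j ∈ Finset.univ.erase k, (if x j = y j then (1 : ℂ) else 0)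

/-- The L-operator `Lₖ(λ) = λ (I ⊗ 𝟙) + (i/2) Σₐ σᵃ ⊗ σₖᵃ` on `ℂ² ⊗ 𝔥_N`. -/
def Lop (N : ℕ) (lam : ℂ) (k : Fin N) : Matrix (Fin 2 × St N) (Fin 2 × St N) ℂ :=
  lam • (1 : Matrix (Fin 2 × St N) (Fin 2 × St N) ℂ) +
    (Complex.I / 2) • ∑ a : Fin 3,
      Matrix.of fun p q : Fin 2 × St N => pauli a p.1 q.1 * siteOp N a k p.2 q.2

/-- The monodromy matrix `T_N(λ) = L_N(λ) L_{N-1}(λ) ⋯ L_1(λ)`. -/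
def monodromy (N : ℕ) (lam : ℂ) : Matrix (Fin 2 × St N) (Fin 2 × St N) ℂ :=
  (((List.finRange N).reverse).map (Lop N lam)).prod

/-- `A_N(λ)`: the (0,0) block of `T_N(λ)` in the auxiliary space. -/
def Aop (N : ℕ) (lam : ℂ) : Matrix (St N) (St N) ℂ :=
  Matrix.of fun x y => monodromy N lam (0, x) (0, y)

/-- `B_N(λ)`: the (0,1) block of `T_N(λ)` in the auxiliary space. -/
def Bop (N : ℕ) (lam : ℂ) : Matrix (St N) (St N) ℂ :=
  Matrix.of fun x y => monodromy N lam (0, x) (1, y)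

/-- `C_N(λ)`: the (1,0) block of `T_N(λ)` in the auxiliary space. -/
def Cop (N : ℕ) (lam : ℂ) : Matrix (St N) (St N) ℂ :=
  Matrix.of fun x y => monodromy N lam (1, x) (0, y)

/-- `D_N(λ)`: the (1,1) block of `T_N(λ)` in the auxiliary space. -/
def Dop (N : ℕ) (lam : ℂ) : Matrix (St N) (St N) ℂ :=
  Matrix.of fun x y => monodromy N lam (1, x) (1, y)

/-- The transfer matrix `τ_N(λ) = A_N(λ) + D_N(λ)`. -/
def tau (N : ℕ) (lam : ℂ) : Matrix (St N) (St N) ℂ := Aop N lam + Dop N lam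

/-- The vacuum vector `|0⟩_N = v₊^{⊗N}`. -/
def vac (N : ℕ) : St N → ℂ := fun x => if x = (fun _ => (0 : Fin 2)) then 1 else 0

/-- Cyclic successor on `Fin N`, implementing periodic boundary conditions. -/
def cyc {N : ℕ} (k : Fin N) : Fin N := ⟨(k.1 + 1) % N, Nat.mod_lt _ k.pos⟩

/-- The XXX Hamiltonian
`ℋ_N = (J/4) Σₖ (σₖ¹σ_{k+1}¹ + σₖ²σ_{k+1}² + σₖ³σ_{k+1}³ − 𝟙)`. -/
def Ham (N : ℕ) (J : ℝ) : Matrix (St N) (St N) ℂ :=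
  ((J : ℂ) / 4) • ∑ k : Fin N,
    ((∑ a : Fin 3, siteOp N a k * siteOp N a (cyc k)) - 1)

/-- The product of creation operators `B_N(λ₁) ⋯ B_N(λ_ℓ)`. -/
def betheProd (N : ℕ) {l : ℕ} (lam : Fin l → ℂ) : Matrix (St N) (St N) ℂ :=
  ((List.finRange l).map fun j => Bop N (lam j)).prod

/-- The Bethe vector `B_N(λ₁) ⋯ B_N(λ_ℓ) |0⟩_N`. -/
def betheVec (N : ℕ) {l : ℕ} (lam : Fin l → ℂ) : St N → ℂ :=
  (betheProd N lam).mulVec (vac N)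

/-- The eigenvalue `Λ(λ; λ₁,…,λ_ℓ)` of the transfer matrix. -/
def Lam (N : ℕ) {l : ℕ} (lam0 : ℂ) (lam : Fin l → ℂ) : ℂ :=
  (lam0 + Complex.I / 2) ^ N * ∏ j, (lam0 - lam j - Complex.I) / (lam0 - lam j) +
    (lam0 - Complex.I / 2) ^ N * ∏ j, (lam j - lam0 - Complex.I) / (lam j - lam0)

/-- The unwanted-term coefficient `Λ_k(λ; λ₁,…,λ_ℓ)`. -/
def LamK (N : ℕ) {l : ℕ} (lam0 : ℂ) (lam : Fin l → ℂ) (k : Fin l) : ℂ :=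
  Complex.I / (lam0 - lam k) *
    ((lam k + Complex.I / 2) ^ N *
        ∏ j ∈ Finset.univ.erase k, (lam k - lam j - Complex.I) / (lam k - lam j) -
      (lam k - Complex.I / 2) ^ N *
        ∏ j ∈ Finset.univ.erase k, (lam j - lam k - Complex.I) / (lam j - lam k))

/-- The Bethe ansatz equations for the spin 1/2 XXX chain of length `N`. -/
def BetheEq (N : ℕ) {l : ℕ} (lam : Fin l → ℂ) : Prop :=
  ∀ k, ((lam k + Complex.I / 2) / (lam k - Complex.I / 2)) ^ N =
    ∏ j ∈ Finset.univ.erase k, (lam k - lam j + Complex.I) / (lam k - lam j - Complex.I)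

/-- Nepomechie–Wang regularization: `λ₁(ε) = i/2 + ε + c ε^N`. -/
def nwLam1 (N : ℕ) (c : ℂ) (eps : ℂ) : ℂ := Complex.I / 2 + eps + c * eps ^ N

/-- Nepomechie–Wang regularization: `λ₂(ε) = −i/2 + ε`. -/
def nwLam2 (eps : ℂ) : ℂ := -(Complex.I / 2) + eps

/-- The regularized tuple `(λ₁(ε), λ₂(ε), λ₃, …, λ_ℓ)`. -/
def nwTuple (N : ℕ) (c : ℂ) {m : ℕ} (mu : Fin m → ℂ) (eps : ℂ) : Fin (m + 2) → ℂ :=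
  Fin.cons (nwLam1 N c eps) (Fin.cons (nwLam2 eps) mu)

/-- The singular tuple `(i/2, −i/2, λ₃, …, λ_ℓ)`. -/
def singTuple {m : ℕ} (mu : Fin m → ℂ) : Fin (m + 2) → ℂ :=
  Fin.cons (Complex.I / 2) (Fin.cons (-(Complex.I / 2)) mu)

section Chain

variable {𝓐 : Type*} [Ring 𝓐]

/-- The family `X n a b` represents commuting copies, indexed by `n < N`, of the matrix units
`E_ab` of `2 × 2` matrices. -/
structure IsMatrixUnits (N : ℕ) (X : ℕ → Fin 2 → Fin 2 → 𝓐) : Prop where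
  mul : ∀ n < N, ∀ a b c d, X n a b * X n c d = if b = c then X n a d else 0
  sum : ∀ n < N, ∑ a, X n a a = 1
  comm : ∀ m < N, ∀ n < N, m ≠ n → ∀ a b c d, Commute (X m a b) (X n c d)

/-- The operator exchanging the sites `m` and `n`. -/
def exch (X : ℕ → Fin 2 → Fin 2 → 𝓐) (m n : ℕ) : 𝓐 := ∑ a, ∑ b, X m a b * X n b a

theorem smul_mul_of_commute {Q : 𝓐} {L M : Matrix (Fin 2) (Fin 2) 𝓐}
    (h : ∀ a b, Commute (L a b) Q) : Q • (L * M) = L * Q • M := by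
  ext a b
  simp only [Matrix.smul_apply, Matrix.mul_apply, smul_eq_mul, Finset.mul_sum, ← mul_assoc,
    (h _ _).eq]

theorem IsMatrixUnits.exch_mul_unit {N : ℕ} {X : ℕ → Fin 2 → Fin 2 → 𝓐}
    (hX : IsMatrixUnits N X) {n : ℕ} (hn : n < N) (m : ℕ) (c a : Fin 2) :
    exch X m n * X n c a = ∑ q, X m c q * X n q a := by
  simp only [exch, Finset.sum_mul, mul_assoc, hX.mul n hn, mul_ite, mul_zero]
  rw [Finset.sum_comm]
  simp

theorem IsMatrixUnits.commute_exch {N : ℕ} {X : ℕ → Fin 2 → Fin 2 → 𝓐}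
    (hX : IsMatrixUnits N X) {k m n : ℕ} (hk : k < N) (hm : m < N)
    (hn : n < N) (hkm : k ≠ m) (hkn : k ≠ n) (a b : Fin 2) : Commute (X k a b) (exch X m n) :=
  Commute.sum_right _ _ _ fun _ _ => Commute.sum_right _ _ _ fun _ _ =>
    (hX.comm k hk m hm hkm _ _ _ _).mul_right (hX.comm k hk n hn hkn _ _ _ _)

variable [Algebra ℂ 𝓐]

/-- The L-operator `u + i P` at site `n`, with `P` the exchange of the site with the auxiliary
space. -/
def chainL (X : ℕ → Fin 2 → Fin 2 → 𝓐) (u : ℂ) (n : ℕ) : Matrix (Fin 2) (Fin 2) 𝓐 :=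
  Matrix.of fun a b => (if a = b then u else 0) • (1 : 𝓐) + I • X n b a

/-- The monodromy matrix of the first `n` sites. -/
def chainT (X : ℕ → Fin 2 → Fin 2 → 𝓐) (u : ℂ) : ℕ → Matrix (Fin 2) (Fin 2) 𝓐
  | 0 => 1
  | n + 1 => chainL X u n * chainT X u n

/-- The derivative of `chainT X u n` in `u` at `u = 0`. -/
def chainD (X : ℕ → Fin 2 → Fin 2 → 𝓐) : ℕ → Matrix (Fin 2) (Fin 2) 𝓐
  | 0 => 0
  | n + 1 => chainT X 0 n + chainL X 0 n * chainD X n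

/-- The `RTT` relation between two monodromy matrices whose spectral parameters differ by `δ`. -/
def RTT (δ : ℂ) (S T : Matrix (Fin 2) (Fin 2) 𝓐) : Prop :=
  ∀ i j k l, δ • (S i j * T k l) + I • (S k j * T i l) =
    δ • (T k l * S i j) + I • (T k j * S i l)

theorem RTT.mul {δ : ℂ} {L L' T T' : Matrix (Fin 2) (Fin 2) 𝓐} (hL : RTT δ L L')
    (hT : RTT δ T T') (h₁ : ∀ a b c d, Commute (T a b) (L' c d))
    (h₂ : ∀ a b c d, Commute (T' a b) (L c d)) : RTT δ (L * T) (L' * T') := by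
  intro i j k l
  have e₁ (i j k l p q) : L i p * T p j * (L' k q * T' q l) =
      L i p * L' k q * (T p j * T' q l) := by
    rw [mul_assoc, ← mul_assoc (T p j), (h₁ _ _ _ _).eq]; simp only [mul_assoc]
  have e₂ (i j k l p q) : L' k q * T' q l * (L i p * T p j) =
      L' k q * L i p * (T' q l * T p j) := by
    rw [mul_assoc, ← mul_assoc (T' q l), (h₂ _ _ _ _).eq]; simp only [mul_assoc]
  have lhs (i j k l) : (L * T) i j * (L' * T') k l =
      ∑ p, ∑ q, L i p * L' k q * (T p j * T' q l) := by
    simp only [Matrix.mul_apply, Finset.sum_mul_sum, e₁]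
  have rhs (i j k l) : (L' * T') k l * (L * T) i j =
      ∑ p, ∑ q, L' k q * L i p * (T' q l * T p j) := by
    simp only [Matrix.mul_apply, Finset.sum_mul_sum, e₂]
    exact Finset.sum_comm
  rw [lhs, lhs, rhs, rhs]
  calc _ = ∑ p, ∑ q, (δ • (L i p * L' k q) + I • (L k p * L' i q)) * (T p j * T' q l) := by
        simp only [add_mul, smul_mul_assoc, Finset.sum_add_distrib, Finset.smul_sum]
    _ = ∑ p, ∑ q, (δ • (L' k q * L i p) + I • (L' k p * L i q)) * (T p j * T' q l) := by
        simp only [hL i _ k _]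
    _ = ∑ p, ∑ q, L' k q * L i p * (δ • (T p j * T' q l)) +
          ∑ q, ∑ p, L' k p * L i q * (I • (T p j * T' q l)) := by
        rw [Finset.sum_comm (s := Finset.univ) (t := Finset.univ)
          (f := fun q p => L' k p * L i q * (I • (T p j * T' q l)))]
        simp only [add_mul, smul_mul_assoc, mul_smul_comm, Finset.sum_add_distrib]
    _ = ∑ p, ∑ q, L' k q * L i p * (δ • (T p j * T' q l) + I • (T q j * T' p l)) := by
        simp only [mul_add, Finset.sum_add_distrib]
    _ = ∑ p, ∑ q, L' k q * L i p * (δ • (T' q l * T p j) + I • (T' q j * T p l)) := by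
        simp only [hT _ j _ l]
    _ = _ := by
        simp only [mul_add, mul_smul_comm, Finset.sum_add_distrib, Finset.smul_sum]

variable {N : ℕ} {X : ℕ → Fin 2 → Fin 2 → 𝓐}

theorem IsMatrixUnits.rtt_chainL (hX : IsMatrixUnits N X) {n : ℕ} (hn : n < N) (u v : ℂ) :
    RTT (u - v) (chainL X u n) (chainL X v n) := by
  intro i j k l
  simp only [chainL, Matrix.of_apply, mul_add, add_mul, smul_mul_assoc, mul_smul_comm, one_mul,
    mul_one, hX.mul n hn]
  rcases eq_or_ne i l with rfl | h1 <;> rcases eq_or_ne k j with rfl | h2 <;>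
    simp only [*, if_true, if_false, ne_eq, not_false_eq_true, Ne.symm, smul_zero, zero_smul] <;>
    module

theorem commute_chainL {u : ℂ} {n : ℕ} {Y : 𝓐} (h : ∀ a b, Commute (X n a b) Y) (a b : Fin 2) :
    Commute (chainL X u n a b) Y :=
  ((Commute.one_left Y).smul_left _).add_left ((h b a).smul_left _)

theorem commute_chainT {u : ℂ} {Y : 𝓐} {n : ℕ} (h : ∀ m < n, ∀ a b, Commute (X m a b) Y)
    (a b : Fin 2) : Commute (chainT X u n a b) Y := by
  induction n generalizing a b with
  | zero =>
    rw [chainT, Matrix.one_apply]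
    split_ifs
    exacts [Commute.one_left Y, Commute.zero_left Y]
  | succ n ih =>
    rw [chainT, Matrix.mul_apply]
    exact Commute.sum_left _ _ _ fun c _ =>
      (commute_chainL (h n n.lt_succ_self) a c).mul_left
        (ih (fun m hm => h m (hm.trans n.lt_succ_self)) c b)

theorem IsMatrixUnits.rtt_chainT (hX : IsMatrixUnits N X) {n : ℕ} (hn : n ≤ N) (u v : ℂ) :
    RTT (u - v) (chainT X u n) (chainT X v n) := by
  induction n with
  | zero =>
    intro i j k l
    simp only [chainT, Matrix.one_apply]
    split_ifs <;> simp
  | succ n ih =>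
    have comm (u v a b c d) : Commute (chainT X u n a b) (chainL X v n c d) :=
      commute_chainT (fun m hm a b => (commute_chainL (fun c d =>
        hX.comm n (by omega) m (by omega) (by omega) c d a b) c d).symm) a b
    exact (hX.rtt_chainL (by omega) u v).mul (ih (by omega)) (comm _ _) (comm _ _)

theorem chainL_eq (u : ℂ) (n : ℕ) : chainL X u n = u • 1 + chainL X 0 n := by
  ext a b
  simp only [chainL, Matrix.of_apply, Matrix.add_apply, Matrix.smul_apply, Matrix.one_apply]
  split_ifs <;> simp

theorem hasDerivAt_chainT (n : ℕ) (φ : 𝓐 →ₗ[ℂ] ℂ) (a b : Fin 2) :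
    HasDerivAt (fun u => φ (chainT X u n a b)) (φ (chainD X n a b)) 0 := by
  induction n generalizing φ a b with
  | zero => simpa [chainT, chainD] using hasDerivAt_const (0 : ℂ) (φ ((1 : Matrix _ _ 𝓐) a b))
  | succ n ih =>
    have e (u : ℂ) : φ (chainT X u (n + 1) a b) = u * φ (chainT X u n a b) +
        ∑ c, (φ ∘ₗ LinearMap.mulLeft ℂ (chainL X 0 n a c)) (chainT X u n c b) := by
      rw [chainT, chainL_eq, add_mul, Matrix.smul_mul, one_mul, Matrix.add_apply, map_add,
        Matrix.smul_apply, map_smul, smul_eq_mul, Matrix.mul_apply, map_sum]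
      rfl
    simp only [e]
    refine (((hasDerivAt_id' (0 : ℂ)).fun_mul (ih φ a b)).fun_add (HasDerivAt.fun_sum fun c _ =>
      ih (φ ∘ₗ LinearMap.mulLeft ℂ (chainL X 0 n a c)) c b)).congr_deriv ?_
    simp [chainD, Matrix.mul_apply]

theorem chainT_succ_eq_mul_first (u : ℂ) (n : ℕ) :
    chainT X u (n + 1) = chainT (fun m => X (m + 1)) u n * chainL X u 0 := by
  induction n with
  | zero => simp [chainT]
  | succ n ih =>
    rw [chainT, ih, ← mul_assoc]
    rfl

theorem chainL_zero_apply (n : ℕ) (a b : Fin 2) : chainL X 0 n a b = I • X n b a := by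
  simp [chainL]

/-- The exchange operator absorbs one of two adjacent L-operators at the shift point. -/
theorem IsMatrixUnits.exch_smul_chainL_mul (hX : IsMatrixUnits N X) {m n : ℕ} (hm : m < N)
    (hn : n < N) (hmn : m ≠ n) :
    exch X m n • (chainL X 0 n * chainL X 0 m) = I • chainL X 0 n := by
  ext a b
  have key (c : Fin 2) : exch X m n * (X n c a * X m b c) = X m c c * X n b a := by
    rw [← mul_assoc, hX.exch_mul_unit hn, Finset.sum_mul]
    simp only [mul_assoc, (hX.comm n hn m hm hmn.symm _ _ _ _).eq]
    simp only [← mul_assoc, hX.mul m hm, ite_mul, zero_mul]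
    simp
  simp only [Matrix.smul_apply, Matrix.mul_apply, chainL_zero_apply, smul_eq_mul, Finset.mul_sum,
    smul_mul_assoc, mul_smul_comm, key]
  rw [← Finset.smul_sum, ← Finset.smul_sum, ← Finset.sum_mul, hX.sum m hm, one_mul]

theorem IsMatrixUnits.exch_mul_trace (hX : IsMatrixUnits N X) {m n : ℕ} (hm : m < N)
    (hn : n < N) (hmn : m ≠ n) {W : Matrix (Fin 2) (Fin 2) 𝓐}
    (hW : ∀ a b c d, Commute (W a b) (X m c d)) :
    exch X n m * (chainL X 0 n * (W * chainL X 0 m)).trace = I • (W * chainL X 0 m).trace := by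
  have key (a b c : Fin 2) :
      exch X n m * (X n b a * (W b c * X m a c)) = X n a a * (W b c * X m b c) := by
    have e : exch X n m * X n b a = ∑ p, X n p a * X m b p := by
      simp only [exch, Finset.sum_mul, mul_assoc, (hX.comm m hm n hn hmn _ _ _ _).eq]
      simp only [← mul_assoc, hX.mul n hn, ite_mul, zero_mul]
      simp
    rw [← mul_assoc, e, Finset.sum_mul]
    have e' (p : Fin 2) : X n p a * X m b p * (W b c * X m a c) =
        if p = a then X n p a * (W b c * X m b c) else 0 := by
      rw [mul_assoc, ← mul_assoc (X m b p), ← (hW _ _ _ _).eq, mul_assoc (W b c), hX.mul m hm]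
      split_ifs <;> simp
    simp [e']
  simp only [Matrix.trace, Matrix.diag, Matrix.mul_apply, chainL_zero_apply, Finset.mul_sum,
    smul_mul_assoc, mul_smul_comm, key, ← Finset.smul_sum]
  rw [Finset.sum_comm]
  congr 2
  refine Finset.sum_congr rfl fun b _ => ?_
  simp only [← Finset.mul_sum]
  rw [← Finset.sum_mul, hX.sum n hn, one_mul]

theorem IsMatrixUnits.smul_chainD (hX : IsMatrixUnits N X) {n : ℕ} (hn : n < N) :
    I • chainD X (n + 1) =
      ∑ k ∈ Finset.range n, exch X k (k + 1) • chainT X 0 (n + 1) + I • chainT X 0 n := by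
  induction n with
  | zero => simp [chainD]
  | succ n ih =>
    rw [chainD, smul_add, ← Matrix.mul_smul, ih (by omega), mul_add, Finset.mul_sum,
      Finset.sum_range_succ, Matrix.mul_smul, ← Matrix.smul_mul,
      ← hX.exch_smul_chainL_mul (m := n) (n := n + 1) (by omega) hn (by omega), Matrix.smul_mul,
      mul_assoc, add_comm]
    congr 2
    refine Finset.sum_congr rfl fun k hk => ?_
    rw [Finset.mem_range] at hk
    exact (smul_mul_of_commute fun a b => commute_chainL (fun a b =>
      hX.commute_exch hn (by omega) (by omega) (by omega) (by omega) a b) a b).symm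

/-- The logarithmic derivative of the transfer matrix at the shift point is the sum of the
exchange operators of neighbouring sites. -/
theorem IsMatrixUnits.sum_exch_mul_trace {n : ℕ} {X : ℕ → Fin 2 → Fin 2 → 𝓐}
    (hX : IsMatrixUnits (n + 2) X) :
    (∑ k ∈ Finset.range (n + 1), exch X k (k + 1) + exch X (n + 1) 0) *
      (chainT X 0 (n + 2)).trace = I • (chainD X (n + 2)).trace := by
  rw [← Matrix.trace_smul, hX.smul_chainD (by omega), Matrix.trace_add, Matrix.trace_sum, add_mul,
    Finset.sum_mul, Matrix.trace_smul I]
  congr 1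
  · simp [Matrix.trace_smul]
  · rw [chainT, chainT_succ_eq_mul_first]
    exact hX.exch_mul_trace (by omega) (by omega) (by omega) fun a b c d =>
      commute_chainT (fun m hm a b =>
        hX.comm (m + 1) (by omega) 0 (by omega) (by omega) a b c d) a b

end Chain

section AlgebraicBetheAnsatz

variable {𝓐 : Type*} [Ring 𝓐] [Algebra ℂ 𝓐] {V : Type*} [AddCommGroup V] [Module ℂ V]

/-- Commuting an operator `A` through a product of creation operators, given the quadratic exchange
relation `hAB` and the action of `A` on the vacuum, encoded by the map `φ Y = Y |0⟩`. -/
theorem exchange_through_prod {S : Type*} [CommMonoid S] (ρ : S →* 𝓐) (b : ℂ → S) (A : ℂ → 𝓐)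
    (c : ℂ) (a : ℂ → ℂ) (φ : 𝓐 →ₗ[ℂ] V) (hφ : ∀ Y x, φ (Y * A x) = a x • φ Y)
    (hAB : ∀ x y, x ≠ y →
      A x * ρ (b y) = (1 - c / (x - y)) • (ρ (b y) * A x) + (c / (x - y)) • (ρ (b x) * A y))
    {ι : Type*} [DecidableEq ι] {μ : ι → ℂ} (hμ : Function.Injective μ) (s : Finset ι) (x : ℂ)
    (hx : ∀ j ∈ s, x ≠ μ j) (Y : 𝓐) :
    φ (Y * A x * ρ (∏ j ∈ s, b (μ j))) =
      (a x * ∏ j ∈ s, (1 - c / (x - μ j))) • φ (Y * ρ (∏ j ∈ s, b (μ j))) +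
      ∑ k ∈ s, (c / (x - μ k) * (a (μ k) * ∏ j ∈ s.erase k, (1 - c / (μ k - μ j)))) •
        φ (Y * ρ (b x * ∏ j ∈ s.erase k, b (μ j))) := by
  induction s using Finset.induction_on generalizing x Y with
  | empty => simp [hφ]
  | insert m s hm ih =>
    have hxm : x ≠ μ m := hx m (Finset.mem_insert_self m s)
    have hxs : ∀ j ∈ s, x ≠ μ j := fun j hj => hx j (Finset.mem_insert_of_mem hj)
    have hms : ∀ j ∈ s, μ m ≠ μ j := fun j hj h => hm (hμ h ▸ hj)
    have split : Y * A x * ρ (b (μ m) * ∏ j ∈ s, b (μ j)) =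
        (1 - c / (x - μ m)) • (Y * ρ (b (μ m)) * A x * ρ (∏ j ∈ s, b (μ j))) +
        (c / (x - μ m)) • (Y * ρ (b x) * A (μ m) * ρ (∏ j ∈ s, b (μ j))) := by
      rw [map_mul, ← mul_assoc, mul_assoc Y, hAB x _ hxm]
      simp only [mul_add, add_mul, mul_smul_comm, smul_mul_assoc, mul_assoc]
    have assoc (p q : S) : Y * ρ p * ρ q = Y * ρ (p * q) := by rw [map_mul, mul_assoc]
    have combine : ∀ k ∈ s,
        (c / (x - μ k) * (a (μ k) * ∏ j ∈ (insert m s).erase k, (1 - c / (μ k - μ j)))) •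
            φ (Y * ρ (b x * ∏ j ∈ (insert m s).erase k, b (μ j))) =
          (1 - c / (x - μ m)) •
            (c / (x - μ k) * (a (μ k) * ∏ j ∈ s.erase k, (1 - c / (μ k - μ j)))) •
              φ (Y * ρ (b (μ m) * (b x * ∏ j ∈ s.erase k, b (μ j)))) +
          (c / (x - μ m)) •
            (c / (μ m - μ k) * (a (μ k) * ∏ j ∈ s.erase k, (1 - c / (μ k - μ j)))) •
              φ (Y * ρ (b x * (b (μ m) * ∏ j ∈ s.erase k, b (μ j)))) := by
      intro k hk
      have hkm : k ≠ m := fun h => hm (h ▸ hk)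
      have hm' : m ∉ s.erase k := fun h => hm (Finset.mem_of_mem_erase h)
      rw [Finset.erase_insert_of_ne hkm.symm, Finset.prod_insert hm', Finset.prod_insert hm',
        mul_left_comm (b (μ m)), smul_smul, smul_smul, ← add_smul]
      congr 1
      have h₁ := sub_ne_zero.2 hxm
      have h₂ := sub_ne_zero.2 (hxs k hk)
      have h₃ := sub_ne_zero.2 (hms k hk)
      have h₄ := sub_ne_zero.2 (hms k hk).symm
      have yb : c / (x - μ k) * (1 - c / (μ k - μ m)) =
          (1 - c / (x - μ m)) * (c / (x - μ k)) + c / (x - μ m) * (c / (μ m - μ k)) := by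
        rw [← neg_sub (μ m) (μ k), div_neg]
        field_simp
        ring
      linear_combination (a (μ k) * ∏ j ∈ s.erase k, (1 - c / (μ k - μ j))) * yb
    rw [Finset.prod_insert hm, Finset.prod_insert hm, Finset.sum_insert hm,
      Finset.erase_insert hm, Finset.sum_congr rfl combine, split, map_add, map_smul, map_smul,
      ih x hxs, ih (μ m) hms]
    simp only [assoc, Finset.sum_add_distrib, smul_add, Finset.smul_sum]
    module

open scoped IsMulCommutative in
/-- A pairwise commuting family in a monoid factors through a commutative monoid. -/
theorem exists_commMonoid_lift.{u} {ι : Type*} {M : Type u} [Monoid M] (B : ι → M)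
    (hB : ∀ i j, B i * B j = B j * B i) :
    ∃ (S : Type u) (_ : CommMonoid S) (ρ : S →* M) (b : ι → S), ∀ i, ρ (b i) = B i := by
  have : IsMulCommutative (Submonoid.closure (Set.range B)) := by
    refine Submonoid.isMulCommutative_closure M ?_
    rintro _ ⟨i, rfl⟩ _ ⟨j, rfl⟩
    exact hB i j
  exact ⟨Submonoid.closure (Set.range B), inferInstance,
    (Submonoid.closure (Set.range B)).subtype,
    fun i => ⟨B i, Submonoid.subset_closure ⟨i, rfl⟩⟩, fun i => rfl⟩

end AlgebraicBetheAnsatz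

section Concrete

/-- The matrix unit `E_ab` acting on the `k`-th tensor factor. -/
def siteUnit (N : ℕ) (k : Fin N) (a b : Fin 2) : Matrix (St N) (St N) ℂ :=
  Matrix.of fun x y => if x k = a ∧ y = Function.update x k b then 1 else 0

theorem siteUnit_mul_apply {N : ℕ} (k : Fin N) (a b : Fin 2) (M : Matrix (St N) (St N) ℂ)
    (x y : St N) :
    (siteUnit N k a b * M) x y = if x k = a then M (Function.update x k b) y else 0 := by
  simp only [Matrix.mul_apply, siteUnit, Matrix.of_apply, ite_and, ite_mul, one_mul, zero_mul]
  split_ifs <;> simp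

theorem siteUnit_mulVec {N : ℕ} (k : Fin N) (a b : Fin 2) (v : St N → ℂ) (x : St N) :
    (siteUnit N k a b).mulVec v x = if x k = a then v (Function.update x k b) else 0 := by
  simp only [Matrix.mulVec, dotProduct, siteUnit, Matrix.of_apply, ite_and, ite_mul, one_mul,
    zero_mul]
  split_ifs <;> simp

theorem siteOp_eq_sum {N : ℕ} (a : Fin 3) (k : Fin N) :
    siteOp N a k = ∑ p, ∑ q, pauli a p q • siteUnit N k p q := by
  ext x y
  have h : (∏ j ∈ Finset.univ.erase k, if x j = y j then (1 : ℂ) else 0) =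
      if y = Function.update x k (y k) then 1 else 0 := by
    rw [Finset.prod_ite_zero]
    simp [Function.eq_update_iff, eq_comm]
  simp only [siteOp, Matrix.of_apply, h, Matrix.sum_apply, Matrix.smul_apply, siteUnit,
    smul_eq_mul]
  rw [Finset.sum_eq_single (x k) (by simp +contextual [eq_comm]) (by simp),
    Finset.sum_eq_single (y k) _ (by simp)]
  · simp
  · rintro q - hq
    rw [if_neg, mul_zero]
    rintro ⟨-, h⟩
    exact hq (by rw [h]; simp)

theorem sum_pauli_mul (p q r s : Fin 2) : ∑ a, pauli a p q * pauli a r s =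
    (if p = s ∧ q = r then 2 else 0) - (if p = q ∧ r = s then 1 else 0) := by
  fin_cases p <;> fin_cases q <;> fin_cases r <;> fin_cases s <;>
    simp [Fin.sum_univ_three, pauli] <;> norm_num

/-- The matrix units of the spin chain of length `N`, extended by zero beyond the chain. -/
def chainX (N : ℕ) (n : ℕ) (a b : Fin 2) : Matrix (St N) (St N) ℂ :=
  if h : n < N then siteUnit N ⟨n, h⟩ a b else 0

theorem chainX_val {N : ℕ} (k : Fin N) (a b : Fin 2) : chainX N k a b = siteUnit N k a b :=
  dif_pos k.2

theorem isMatrixUnits_chainX (N : ℕ) : IsMatrixUnits N (chainX N) where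
  mul n hn a b c d := by
    lift n to Fin N using hn
    ext x y
    simp only [chainX_val, siteUnit_mul_apply]
    by_cases hbc : b = c <;> simp [siteUnit, hbc, ite_and]
  sum n hn := by
    lift n to Fin N using hn
    ext x y
    simp only [chainX_val, siteUnit, Matrix.sum_apply, Matrix.of_apply, ite_and]
    simp [Matrix.one_apply, eq_comm]
  comm m hm n hn hmn a b c d := by
    lift m to Fin N using hm
    lift n to Fin N using hn
    have hmn : m ≠ n := fun h => hmn (congrArg _ h)
    ext x y
    simp only [chainX_val, siteUnit_mul_apply]
    simp only [siteUnit, Matrix.of_apply, ite_and, Function.update_of_ne hmn,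
      Function.update_of_ne hmn.symm, Function.update_comm hmn]
    split_ifs <;> rfl

theorem comp_chainL {N : ℕ} (lam : ℂ) (k : Fin N) :
    Matrix.comp _ _ _ _ _ (chainL (chainX N) (lam - I / 2) k) = Lop N lam k := by
  ext ⟨a, x⟩ ⟨b, y⟩
  have h : ∑ i : Fin 3, pauli i a b • siteOp N i k =
      (2 : ℂ) • siteUnit N k b a - (if a = b then (1 : ℂ) else 0) • 1 := by
    rw [← (isMatrixUnits_chainX N).sum k k.2]
    calc ∑ i, pauli i a b • siteOp N i k
        = ∑ p, ∑ q, (∑ i, pauli i a b * pauli i p q) • siteUnit N k p q := by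
          simp only [siteOp_eq_sum, Fin.sum_univ_three, Fin.sum_univ_two]
          module
      _ = _ := by
          simp only [sum_pauli_mul, Fin.sum_univ_two, chainX_val]
          fin_cases a <;> fin_cases b <;> simp <;> module
  have h' := congrFun (congrFun h x) y
  simp only [Matrix.sum_apply, Matrix.smul_apply, Matrix.sub_apply, smul_eq_mul] at h'
  simp only [Matrix.comp_apply, chainL, Matrix.of_apply, chainX_val, Lop, Matrix.add_apply,
    Matrix.smul_apply, Matrix.sum_apply, h', smul_eq_mul, Matrix.one_apply, Prod.mk.injEq]
  split_ifs <;> simp_all <;> ring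

theorem comp_chainT (N : ℕ) (lam : ℂ) :
    Matrix.comp _ _ _ _ _ (chainT (chainX N) (lam - I / 2) N) = monodromy N lam := by
  have h (n : ℕ) : chainT (chainX N) (lam - I / 2) n =
      ((List.range n).reverse.map (chainL (chainX N) (lam - I / 2))).prod := by
    induction n with
    | zero => rfl
    | succ n ih => simp [chainT, ih, List.range_succ]
  rw [h, ← List.map_coe_finRange_eq_range, ← List.map_reverse, List.map_map, monodromy,
    ← Matrix.compRingEquiv_apply, map_list_prod, List.map_map]
  congr 2
  funext k
  exact comp_chainL lam k

theorem sum_siteOp_mul {N : ℕ} (k m : Fin N) :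
    ∑ a, siteOp N a k * siteOp N a m = (2 : ℂ) • exch (chainX N) k m - 1 := by
  have h₁ : (1 : Matrix (St N) (St N) ℂ) = ∑ p, ∑ r, siteUnit N k p p * siteUnit N m r r := by
    rw [← Finset.sum_mul_sum]
    simp only [← chainX_val, (isMatrixUnits_chainX N).sum _ (Fin.is_lt _), one_mul]
  calc ∑ a, siteOp N a k * siteOp N a m
      = ∑ p, ∑ q, ∑ r, ∑ s, (∑ a, pauli a p q * pauli a r s) •
          (siteUnit N k p q * siteUnit N m r s) := by
        simp only [siteOp_eq_sum, Fin.sum_univ_three, Fin.sum_univ_two, add_mul, mul_add,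
          smul_mul_smul_comm]
        module
    _ = _ := by
        rw [h₁]
        simp only [sum_pauli_mul, Fin.sum_univ_two, exch, chainX_val]
        simp
        module

theorem sum_cyc {M : Type*} [AddCommMonoid M] (n : ℕ) (f : ℕ → ℕ → M) :
    ∑ k : Fin (n + 2), f k (cyc k) =
      ∑ k ∈ Finset.range (n + 1), f k (k + 1) + f (n + 1) 0 := by
  rw [Fin.sum_univ_castSucc, Finset.sum_range]
  congr 1
  · refine Finset.sum_congr rfl fun k _ => ?_
    have : (k : ℕ) + 1 < n + 2 := by omega
    simp [cyc, Nat.mod_eq_of_lt this]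
  · simp [cyc]

theorem Ham_eq (n : ℕ) (J : ℝ) : Ham (n + 2) J = ((J : ℂ) / 2) •
    ((∑ k ∈ Finset.range (n + 1), exch (chainX (n + 2)) k (k + 1) +
      exch (chainX (n + 2)) (n + 1) 0) - ((n + 2 : ℕ) : ℂ) • 1) := by
  have h := sum_cyc n (exch (chainX (n + 2)))
  simp only [Ham, sum_siteOp_mul, Finset.sum_sub_distrib, ← Finset.smul_sum, h]
  simp only [Finset.sum_const, Finset.card_univ, Fintype.card_fin, ← Nat.cast_smul_eq_nsmul ℂ]
  module

theorem chainX_zero_zero_mulVec_vac {N n : ℕ} (hn : n < N) :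
    (chainX N n 0 0).mulVec (vac N) = vac N := by
  lift n to Fin N using hn
  ext x
  rw [chainX_val, siteUnit_mulVec]
  split_ifs with hx
  · rw [← hx, Function.update_eq_self]
  · rw [vac, if_neg]
    rintro rfl
    exact hx rfl

theorem chainX_one_mulVec_vac {N n : ℕ} (hn : n < N) (a : Fin 2) :
    (chainX N n a 1).mulVec (vac N) = 0 := by
  lift n to Fin N using hn
  ext x
  have h : Function.update x n 1 ≠ fun _ => 0 := fun h => by simpa using congrFun h n
  rw [chainX_val, siteUnit_mulVec, vac, if_neg h, ite_self, Pi.zero_apply]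

theorem chainT_mulVec_vac {N : ℕ} (u : ℂ) {n : ℕ} (hn : n ≤ N) :
    (chainT (chainX N) u n 0 0).mulVec (vac N) = (u + I) ^ n • vac N ∧
    (chainT (chainX N) u n 1 0).mulVec (vac N) = 0 ∧
    (chainT (chainX N) u n 1 1).mulVec (vac N) = u ^ n • vac N := by
  induction n with
  | zero => simp [chainT]
  | succ n ih =>
    obtain ⟨h₀₀, h₁₀, h₁₁⟩ := ih (by omega)
    have hc : chainX N n 0 1 * chainT (chainX N) u n 0 1 =
        chainT (chainX N) u n 0 1 * chainX N n 0 1 :=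
      (commute_chainT (fun m hm a b => (isMatrixUnits_chainX N).comm m (by omega) n hn (by omega)
        a b 0 1) 0 1).eq.symm
    simp only [chainT, Matrix.mul_apply, Fin.sum_univ_two, chainL, Matrix.of_apply, add_mul,
      smul_mul_assoc, one_mul, Matrix.add_mulVec, Matrix.smul_mulVec, hc, ← Matrix.mulVec_mulVec,
      h₀₀, h₁₀, h₁₁, Matrix.mulVec_smul,
      chainX_zero_zero_mulVec_vac hn, chainX_one_mulVec_vac hn]
    refine ⟨?_, ?_, ?_⟩
    · simp
      module
    · simp
    · simp
      module

theorem Bop_eq (N : ℕ) (x : ℂ) : Bop N x = chainT (chainX N) (x - I / 2) N 0 1 := by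
  ext s t
  rw [Bop, ← comp_chainT]
  rfl

end Concrete

section Energy

/-- The Bethe equations are the vanishing of the unwanted terms. -/
theorem bethe_balance {N l : ℕ} {lam : Fin l → ℂ} (hinj : Function.Injective lam)
    (hp : ∀ j, lam j ≠ I / 2) (hstr : ∀ j k : Fin l, j ≠ k → lam k - lam j ≠ I)
    (hBAE : BetheEq N lam) (k : Fin l) :
    (lam k + I / 2) ^ N * ∏ j ∈ Finset.univ.erase k, (1 - I / (lam k - lam j)) =
      (lam k - I / 2) ^ N * ∏ j ∈ Finset.univ.erase k, (1 - -I / (lam k - lam j)) := by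
  have e : ∀ j ∈ Finset.univ.erase k, 1 - -I / (lam k - lam j) =
      (lam k - lam j + I) / (lam k - lam j - I) * (1 - I / (lam k - lam j)) := by
    intro j hj
    have hjk := Finset.ne_of_mem_erase hj
    have h₁ : lam k - lam j ≠ 0 := sub_ne_zero.2 fun h => hjk (hinj h).symm
    have h₂ : lam k - lam j - I ≠ 0 := sub_ne_zero.2 (hstr j k hjk)
    field_simp
    ring
  have h : (lam k - I / 2) ^ N ≠ 0 := pow_ne_zero _ (sub_ne_zero.2 (hp k))
  rw [Finset.prod_congr rfl e, Finset.prod_mul_distrib, ← hBAE k, div_pow, ← mul_assoc,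
    mul_div_cancel₀ _ h]

/-- The eigenvalue of the transfer matrix on a Bethe vector, with the spectral parameter shifted
by `i/2`. -/
def shiftedLam (N : ℕ) {l : ℕ} (lam : Fin l → ℂ) (u : ℂ) : ℂ :=
  (u + I) ^ N * ∏ j, (1 - I / (u + I / 2 - lam j)) + u ^ N * ∏ j, (1 - -I / (u + I / 2 - lam j))

theorem Bop_comm (N : ℕ) (x y : ℂ) : Bop N x * Bop N y = Bop N y * Bop N x := by
  have h (x y : ℂ) : (x - y + I) • (Bop N x * Bop N y) = (x - y + I) • (Bop N y * Bop N x) := by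
    have h := (isMatrixUnits_chainX N).rtt_chainT le_rfl (x - I / 2) (y - I / 2) 0 1 0 1
    rwa [sub_sub_sub_cancel_right, ← Bop_eq, ← Bop_eq, ← add_smul, ← add_smul] at h
  by_cases hxy : x - y + I = 0
  · refine (smul_right_injective _ (r := y - x + I) ?_ (h y x)).symm
    rw [show y - x + I = 2 * I by linear_combination -hxy]
    simp
  · exact smul_right_injective _ hxy (h x y)

/-- Bethe vectors are eigenvectors of the transfer matrix. -/
theorem transfer_mulVec_betheVec {N l : ℕ} {lam : Fin l → ℂ} (hinj : Function.Injective lam)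
    (hp : ∀ j, lam j ≠ I / 2) (hstr : ∀ j k : Fin l, j ≠ k → lam k - lam j ≠ I)
    (hBAE : BetheEq N lam) {u : ℂ} (hu : ∀ j, u + I / 2 ≠ lam j) :
    (chainT (chainX N) u N).trace.mulVec (betheVec N lam) =
      shiftedLam N lam u • betheVec N lam := by
  obtain ⟨S, _, ρ, b, hb⟩ := exists_commMonoid_lift (Bop N) (Bop_comm N)
  let φ : Matrix (St N) (St N) ℂ →ₗ[ℂ] (St N → ℂ) := (Matrix.mulVecBilin ℂ ℂ).flip (vac N)
  have hφ (Y : Matrix (St N) (St N) ℂ) : φ Y = Y.mulVec (vac N) := rfl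
  let T (x : ℂ) := chainT (chainX N) (x - I / 2) N
  have hT (x : ℂ) : ρ (b x) = T x 0 1 := (hb x).trans (Bop_eq N x)
  have hvac (x : ℂ) := chainT_mulVec_vac (N := N) (x - I / 2) le_rfl
  have rtt (x y : ℂ) : RTT (x - y) (T x) (T y) := by
    simpa only [sub_sub_sub_cancel_right] using
      (isMatrixUnits_chainX N).rtt_chainT le_rfl (x - I / 2) (y - I / 2)
  have hΨ : betheVec N lam = φ (ρ (∏ j, b (lam j))) := by
    rw [hφ, betheVec, betheProd, Fin.prod_univ_def, map_list_prod, List.map_map]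
    congr 3
    funext j
    exact (hb _).symm
  have hA (Y x) : φ (Y * T x 0 0) = (x + I / 2) ^ N • φ Y := by
    rw [hφ, ← Matrix.mulVec_mulVec, (hvac x).1, Matrix.mulVec_smul]
    congr 2
    ring
  have hD (Y x) : φ (Y * T x 1 1) = (x - I / 2) ^ N • φ Y := by
    rw [hφ, ← Matrix.mulVec_mulVec, (hvac x).2.2, Matrix.mulVec_smul]
    rfl
  have solve {d c : ℂ} (hd : d ≠ 0) {P Q R : Matrix (St N) (St N) ℂ}
      (h : d • P = (d - c) • Q + c • R) : P = (1 - c / d) • Q + (c / d) • R := by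
    refine smul_right_injective _ hd ?_
    simp only [h, smul_add, smul_smul, mul_sub, mul_one, mul_div_cancel₀ _ hd]
  have hAB (x y : ℂ) (hxy : x ≠ y) : T x 0 0 * ρ (b y) =
      (1 - I / (x - y)) • (ρ (b y) * T x 0 0) + (I / (x - y)) • (ρ (b x) * T y 0 0) := by
    have h := rtt y x 0 1 0 0
    rw [← hT, ← hT] at h
    refine solve (sub_ne_zero.2 hxy) ?_
    linear_combination (norm := module) h
  have hDB (x y : ℂ) (hxy : x ≠ y) : T x 1 1 * ρ (b y) =
      (1 - -I / (x - y)) • (ρ (b y) * T x 1 1) + (-I / (x - y)) • (ρ (b x) * T y 1 1) := by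
    have h := rtt x y 1 1 0 1
    rw [← hT, ← hT] at h
    refine solve (sub_ne_zero.2 hxy) ?_
    linear_combination (norm := module) h
  obtain ⟨x, rfl⟩ : ∃ x, u = x - I / 2 := ⟨u + I / 2, by ring⟩
  simp only [sub_add_cancel] at hu
  have h₁ := exchange_through_prod ρ b (T · 0 0) I (fun x => (x + I / 2) ^ N) φ hA hAB hinj
    Finset.univ x (fun j _ => hu j) 1
  have h₂ := exchange_through_prod ρ b (T · 1 1) (-I) (fun x => (x - I / 2) ^ N) φ hD hDB hinj
    Finset.univ x (fun j _ => hu j) 1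
  simp only [one_mul] at h₁ h₂
  have h : (chainT (chainX N) (x - I / 2) N).trace.mulVec (betheVec N lam) =
      φ (T x 0 0 * ρ (∏ j, b (lam j))) + φ (T x 1 1 * ρ (∏ j, b (lam j))) := by
    rw [Matrix.trace_fin_two, Matrix.add_mulVec, hΨ, hφ, hφ, hφ, Matrix.mulVec_mulVec,
      Matrix.mulVec_mulVec]
  rw [h, h₁, h₂, add_add_add_comm, ← add_smul, ← Finset.sum_add_distrib, Finset.sum_eq_zero, hΨ,
    add_zero]
  · congr 1
    simp only [shiftedLam, sub_add_cancel]
    ring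
  · intro k _
    rw [← add_smul, ← bethe_balance hinj hp hstr hBAE k, neg_div, neg_mul, add_neg_cancel,
      zero_smul]

/-- The logarithmic derivative of a finite product is the sum of the logarithmic derivatives. -/
theorem hasDerivAt_prod_of_logDeriv {ι : Type*} {s : Finset ι} {f : ι → ℂ → ℂ}
    {c : ι → ℂ} {x : ℂ} (h : ∀ j ∈ s, HasDerivAt (f j) (f j x * c j) x) :
    HasDerivAt (fun u => ∏ j ∈ s, f j u) ((∏ j ∈ s, f j x) * ∑ j ∈ s, c j) x := by
  classical
  refine (HasDerivAt.fun_finsetProd h).congr_deriv ?_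
  rw [Finset.mul_sum]
  refine Finset.sum_congr rfl fun j hj => ?_
  rw [smul_eq_mul, ← Finset.prod_erase_mul s _ hj, mul_assoc]

theorem shiftedLam_zero {N l : ℕ} (hN : 2 ≤ N) (lam : Fin l → ℂ) :
    shiftedLam N lam 0 = I ^ N * ∏ j, (1 - I / (I / 2 - lam j)) := by
  simp [shiftedLam, show N ≠ 0 by omega]

theorem hasDerivAt_shiftedLam {N l : ℕ} (hN : 2 ≤ N) {lam : Fin l → ℂ}
    (hp : ∀ j, lam j ≠ I / 2) (hm : ∀ j, lam j ≠ -(I / 2)) :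
    HasDerivAt (shiftedLam N lam)
      (shiftedLam N lam 0 * (-I * (N - ∑ j, 1 / (lam j ^ 2 + 1 / 4)))) 0 := by
  have hr (j) : (0 : ℂ) + I / 2 - lam j ≠ 0 := by
    rw [zero_add]
    exact sub_ne_zero.2 (hp j).symm
  have hden (j) : HasDerivAt (fun u : ℂ => u + I / 2 - lam j) 1 0 :=
    ((hasDerivAt_id' (0 : ℂ)).add_const (I / 2)).sub_const (lam j)
  have hfac (c : ℂ) (j) : HasDerivAt (fun u : ℂ => 1 - c / (u + I / 2 - lam j))
      (c / (0 + I / 2 - lam j) ^ 2) 0 := by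
    refine (((hasDerivAt_const (0 : ℂ) c).fun_div (hden j) (hr j)).const_sub 1).congr_deriv ?_
    ring
  have h₁ : HasDerivAt (fun u : ℂ => ∏ j, (1 - I / (u + I / 2 - lam j)))
      ((∏ j, (1 - I / (0 + I / 2 - lam j))) * ∑ j, I * (1 / (lam j ^ 2 + 1 / 4))) 0 := by
    refine hasDerivAt_prod_of_logDeriv fun j _ => (hfac I j).congr_deriv ?_
    have h₂ : 0 + I / 2 - lam j - I ≠ 0 := fun h => hm j (by linear_combination -h)
    rw [show lam j ^ 2 + 1 / 4 = (0 + I / 2 - lam j) * (0 + I / 2 - lam j - I) by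
      linear_combination (1 / 4 : ℂ) * I_sq, one_sub_div (hr j)]
    have h₃ := hr j
    generalize 0 + I / 2 - lam j = r at *
    field_simp
  have h₂ : HasDerivAt (fun u : ℂ => ∏ j, (1 - -I / (u + I / 2 - lam j))) _ 0 :=
    HasDerivAt.fun_finsetProd fun j _ => hfac (-I) j
  have h := ((((hasDerivAt_id' (0 : ℂ)).add_const I).fun_pow N).fun_mul h₁).fun_add
    (((hasDerivAt_id' (0 : ℂ)).fun_pow N).fun_mul h₂)
  refine h.congr_deriv ?_
  obtain ⟨n, rfl⟩ := Nat.exists_eq_add_of_le' hN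
  rw [shiftedLam_zero hN, ← Finset.mul_sum]
  simp only [zero_add, smul_eq_mul, Nat.add_succ_sub_one, ne_eq, Nat.add_eq_zero_iff,
    OfNat.ofNat_ne_zero, one_ne_zero, and_false, not_false_eq_true, zero_pow]
  linear_combination ((n + 2 : ℕ) * I ^ (n + 1) * ∏ j, (1 - I / (I / 2 - lam j))) * I_sq

theorem shiftedLam_zero_ne_zero {N l : ℕ} (hN : 2 ≤ N) {lam : Fin l → ℂ}
    (hp : ∀ j, lam j ≠ I / 2) (hm : ∀ j, lam j ≠ -(I / 2)) : shiftedLam N lam 0 ≠ 0 := by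
  rw [shiftedLam_zero hN]
  refine mul_ne_zero (pow_ne_zero _ I_ne_zero) (Finset.prod_ne_zero_iff.2 fun j _ => ?_)
  rw [one_sub_div (sub_ne_zero.2 (hp j).symm)]
  refine div_ne_zero (fun h => hm j ?_) (sub_ne_zero.2 (hp j).symm)
  linear_combination -h

end Energy

/-- Energy eigenvalue of a regular Bethe vector:
`ℋ_N Ψ = ℰ Ψ` with `ℰ = −(J/2) Σⱼ 1/(λⱼ² + 1/4)`. -/
theorem bethe_vector_energy (N : ℕ) (hN : 2 ≤ N) (J : ℝ) {l : ℕ}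
    (lam : Fin l → ℂ) (hinj : Function.Injective lam)
    (hp : ∀ j, lam j ≠ Complex.I / 2) (hm : ∀ j, lam j ≠ -(Complex.I / 2))
    (hstr : ∀ j k : Fin l, j ≠ k → lam k - lam j ≠ Complex.I)
    (hBAE : BetheEq N lam) :
    (Ham N J).mulVec (betheVec N lam) =
      (-((J : ℂ) / 2) * ∑ j, 1 / ((lam j) ^ 2 + 1 / 4)) • betheVec N lam := by
  have hT {u : ℂ} (hu : ∀ j, u + I / 2 ≠ lam j) :=
    transfer_mulVec_betheVec hinj hp hstr hBAE hu
  have h₀ : ∀ j, (0 : ℂ) + I / 2 ≠ lam j := fun j => by rw [zero_add]; exact (hp j).symm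
  have hD : (chainD (chainX N) N).trace.mulVec (betheVec N lam) =
      (shiftedLam N lam 0 * (-I * (N - ∑ j, 1 / (lam j ^ 2 + 1 / 4)))) • betheVec N lam := by
    ext y
    let φ : Matrix (St N) (St N) ℂ →ₗ[ℂ] ℂ :=
      LinearMap.proj y ∘ₗ (Matrix.mulVecBilin ℂ ℂ).flip (betheVec N lam)
    have h₁ : HasDerivAt (fun u => φ (chainT (chainX N) u N).trace)
        (φ (chainD (chainX N) N).trace) 0 := by
      simp only [Matrix.trace, map_sum]
      exact HasDerivAt.fun_sum fun a _ => hasDerivAt_chainT N φ a a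
    have h₂ := (hasDerivAt_shiftedLam hN hp hm).mul_const (betheVec N lam y)
    refine h₁.unique (h₂.congr_of_eventuallyEq ?_)
    have hev : ∀ᶠ u : ℂ in 𝓝 0, ∀ j, u + I / 2 ≠ lam j :=
      eventually_all.2 fun j => ContinuousAt.eventually_ne (by fun_prop) (h₀ j)
    filter_upwards [hev] with u hu
    exact congrFun (hT hu) y
  obtain ⟨n, rfl⟩ := Nat.exists_eq_add_of_le' hN
  have hQ := congrArg (Matrix.mulVec · (betheVec (n + 2) lam))
    (isMatrixUnits_chainX (n + 2)).sum_exch_mul_trace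
  simp only [← Matrix.mulVec_mulVec, hT h₀, Matrix.smul_mulVec, hD, Matrix.mulVec_smul] at hQ
  have hQ' := smul_right_injective _ (shiftedLam_zero_ne_zero hN hp hm) (hQ.trans (by
    rw [smul_smul, mul_left_comm, ← smul_smul]))
  rw [Ham_eq, Matrix.smul_mulVec, Matrix.sub_mulVec, hQ', Matrix.smul_mulVec, Matrix.one_mulVec,
    ← sub_smul, smul_smul]
  congr 1
  linear_combination (-(J : ℂ) / 2 * (((n + 2 : ℕ) : ℂ) - ∑ j, 1 / (lam j ^ 2 + 1 / 4))) * I_sq
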